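/- Let (ζ_n)_{n≥0} be a strictly increasing sequence of positive real numbers with Σ_{n≥0} 1/ζ_n² < ∞, let β > 0 and 0 < ε ≤ 1. Then the function T(r) = (2/β)·Σ_{n≥0} ( ζ_n²·r²/(ζ_n⁴ − r⁴) + sin(πε/2)·r⁴/(ζ_n⁴ − r⁴) ) − sin(πε/2) is strictly increasing on (0, ζ_0), satisfies T(r) → −sin(πε/2) < 0 as r → 0⁺ and T(r) → ∞ as r → ζ_0⁻; consequently T has a unique zero in (0, ζ_0). -/

import Mathlib

section

open Filter Topology Set

/-- The summand contributed by a zero `a` to the radius equation with parameter `s`. -/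
noncomputable def starlikeTerm (s a r : ℝ) : ℝ :=
  a ^ 2 * r ^ 2 / (a ^ 4 - r ^ 4) + s * r ^ 4 / (a ^ 4 - r ^ 4)

lemma pow_four_sub_pos {a r : ℝ} (hr : 0 ≤ r) (hra : r < a) : 0 < a ^ 4 - r ^ 4 :=
  sub_pos.2 (pow_lt_pow_left₀ hra hr (by norm_num))

lemma starlikeTerm_nonneg {s a r : ℝ} (hs : 0 ≤ s) (hr : 0 ≤ r) (hra : r < a) :
    0 ≤ starlikeTerm s a r := by
  have := pow_four_sub_pos hr hra
  unfold starlikeTerm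
  positivity

lemma strictMonoOn_starlikeTerm {s a : ℝ} (hs : 0 ≤ s) :
    StrictMonoOn (starlikeTerm s a) (Ico 0 a) := by
  rintro x ⟨hx, hxa⟩ y ⟨hy, hya⟩ hxy
  have ha : 0 < a := hx.trans_lt hxa
  have hdy := pow_four_sub_pos hy hya
  have hden : a ^ 4 - y ^ 4 ≤ a ^ 4 - x ^ 4 := by gcongr
  refine add_lt_add_of_lt_of_le ?_ ?_
  · exact div_lt_div₀ (by gcongr) hden (by positivity) hdy
  · exact div_le_div₀ (by positivity) (by gcongr) hdy hden

lemma continuousOn_starlikeTerm (s a : ℝ) : ContinuousOn (starlikeTerm s a) (Ico 0 a) := by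
  have h : ∀ r ∈ Ico 0 a, a ^ 4 - r ^ 4 ≠ 0 := fun r hr => (pow_four_sub_pos hr.1 hr.2).ne'
  unfold starlikeTerm
  fun_prop (disch := assumption)

lemma starlikeTerm_le {s a c r : ℝ} (hs : 0 ≤ s) (hr : 0 ≤ r) (hrc : r < c) (hca : c ≤ a) :
    starlikeTerm s a r ≤ (1 + s) * r ^ 2 / (1 - r ^ 4 / c ^ 4) * (1 / a ^ 2) := by
  have hc : 0 < c := hr.trans_lt hrc
  have ha : 0 < a := hc.trans_le hca
  have hpos : 0 < 1 - r ^ 4 / c ^ 4 := by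
    rw [sub_pos, div_lt_one (by positivity)]
    exact pow_lt_pow_left₀ hrc hr (by norm_num)
  have hden : a ^ 4 * (1 - r ^ 4 / c ^ 4) ≤ a ^ 4 - r ^ 4 := by
    have : r ^ 4 ≤ a ^ 4 * (r ^ 4 / c ^ 4) := by
      rw [mul_div_assoc', le_div_iff₀ (by positivity), mul_comm]
      gcongr
    linarith
  have hnum : a ^ 2 * r ^ 2 + s * r ^ 4 ≤ (1 + s) * r ^ 2 * a ^ 2 := by
    have h : r ^ 2 ≤ a ^ 2 := by gcongr; exact hrc.le.trans hca
    nlinarith [mul_le_mul_of_nonneg_left h (mul_nonneg hs (sq_nonneg r))]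
  calc starlikeTerm s a r = (a ^ 2 * r ^ 2 + s * r ^ 4) / (a ^ 4 - r ^ 4) := (add_div ..).symm
    _ ≤ ((1 + s) * r ^ 2 * a ^ 2) / (a ^ 4 * (1 - r ^ 4 / c ^ 4)) :=
      div_le_div₀ (by positivity) hnum (by positivity) hden
    _ = _ := by
      generalize 1 - r ^ 4 / c ^ 4 = d at hpos
      field_simp

section Series

variable {ζ : ℕ → ℝ} {s : ℝ}

lemma summable_starlikeTerm (hζ : Monotone ζ) (hsum : Summable fun n => 1 / ζ n ^ 2)
    (hs : 0 ≤ s) {r : ℝ} (hr : r ∈ Ico 0 (ζ 0)) : Summable fun n => starlikeTerm s (ζ n) r :=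
  (hsum.mul_left _).of_nonneg_of_le
    (fun n => starlikeTerm_nonneg hs hr.1 (hr.2.trans_le (hζ n.zero_le)))
    fun n => starlikeTerm_le hs hr.1 hr.2 (hζ n.zero_le)

lemma strictMonoOn_tsum_starlikeTerm (hζ : Monotone ζ) (hsum : Summable fun n => 1 / ζ n ^ 2)
    (hs : 0 ≤ s) : StrictMonoOn (fun r => ∑' n, starlikeTerm s (ζ n) r) (Ico 0 (ζ 0)) := by
  intro x hx y hy hxy
  have hlt (n : ℕ) : starlikeTerm s (ζ n) x < starlikeTerm s (ζ n) y :=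
    strictMonoOn_starlikeTerm hs ⟨hx.1, hx.2.trans_le (hζ n.zero_le)⟩
      ⟨hy.1, hy.2.trans_le (hζ n.zero_le)⟩ hxy
  exact (summable_starlikeTerm hζ hsum hs hx).tsum_lt_tsum (fun n => (hlt n).le) (hlt 0)
    (summable_starlikeTerm hζ hsum hs hy)

lemma continuousOn_tsum_starlikeTerm (hζ : Monotone ζ) (hsum : Summable fun n => 1 / ζ n ^ 2)
    (hs : 0 ≤ s) : ContinuousOn (fun r => ∑' n, starlikeTerm s (ζ n) r) (Ico 0 (ζ 0)) := by
  intro x hx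
  obtain ⟨ρ, hxρ, hρ⟩ := exists_between hx.2
  have hρ0 : 0 ≤ ρ := hx.1.trans hxρ.le
  have hsub (n : ℕ) : Ico 0 ρ ⊆ Ico 0 (ζ n) :=
    Ico_subset_Ico_right (hρ.le.trans (hζ n.zero_le))
  have hcont : ContinuousOn (fun r => ∑' n, starlikeTerm s (ζ n) r) (Ico 0 ρ) := by
    refine continuousOn_tsum (fun n => (continuousOn_starlikeTerm s (ζ n)).mono (hsub n))
      (summable_starlikeTerm hζ hsum hs ⟨hρ0, hρ⟩) fun n r hr => ?_
    rw [Real.norm_of_nonneg (starlikeTerm_nonneg hs (hsub n hr).1 (hsub n hr).2)]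
    exact (strictMonoOn_starlikeTerm hs).monotoneOn (hsub n hr)
      ⟨hρ0, hρ.trans_le (hζ n.zero_le)⟩ hr.2.le
  refine (hcont x ⟨hx.1, hxρ⟩).mono_of_mem_nhdsWithin ?_
  filter_upwards [self_mem_nhdsWithin, mem_nhdsWithin_of_mem_nhds (Iio_mem_nhds hxρ)]
    with y hy hyρ using ⟨hy.1, hyρ⟩

lemma tendsto_starlikeTerm_atTop {a : ℝ} (hs : 0 ≤ s) (ha : 0 < a) :
    Tendsto (starlikeTerm s a) (𝓝[<] a) atTop := by
  have hden : Tendsto (fun r : ℝ => a ^ 4 - r ^ 4) (𝓝[<] a) (𝓝[>] 0) := by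
    refine tendsto_nhdsWithin_iff.2 ⟨?_, ?_⟩
    · have h : Continuous fun r : ℝ => a ^ 4 - r ^ 4 := by fun_prop
      simpa using (h.tendsto a).mono_left nhdsWithin_le_nhds
    · filter_upwards [Ioo_mem_nhdsLT ha] with r hr using pow_four_sub_pos hr.1.le hr.2
  have hnum : Tendsto (fun r : ℝ => a ^ 2 * r ^ 2 + s * r ^ 4) (𝓝[<] a)
      (𝓝 (a ^ 2 * a ^ 2 + s * a ^ 4)) := by
    have h : Continuous fun r : ℝ => a ^ 2 * r ^ 2 + s * r ^ 4 := by fun_prop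
    exact (h.tendsto a).mono_left nhdsWithin_le_nhds
  refine (hnum.pos_mul_atTop (by positivity) hden.inv_tendsto_nhdsGT_zero).congr fun r => ?_
  simp only [starlikeTerm, Pi.inv_apply, div_eq_mul_inv, add_mul]

lemma tendsto_tsum_starlikeTerm_atTop (hζ : Monotone ζ) (hpos : 0 < ζ 0)
    (hsum : Summable fun n => 1 / ζ n ^ 2) (hs : 0 ≤ s) :
    Tendsto (fun r => ∑' n, starlikeTerm s (ζ n) r) (𝓝[<] ζ 0) atTop := by
  refine tendsto_atTop_mono' _ ?_ (tendsto_starlikeTerm_atTop hs hpos)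
  filter_upwards [Ioo_mem_nhdsLT hpos] with r hr
  exact (summable_starlikeTerm hζ hsum hs ⟨hr.1.le, hr.2⟩).le_tsum 0
    fun n _ => starlikeTerm_nonneg hs hr.1.le (hr.2.trans_le (hζ n.zero_le))

end Series

end

open Filter Topology Real in
/-- **Existence and uniqueness of the strong-starlikeness radius root.**
For a strictly increasing sequence `(ζₙ)` of positive reals with `∑ 1/ζₙ² < ∞`, `β > 0`
and `0 < ε ≤ 1`, the function
`T r = (2/β)·∑ (ζₙ²r²/(ζₙ⁴ − r⁴) + sin(πε/2)·r⁴/(ζₙ⁴ − r⁴)) − sin(πε/2)` is strictly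
increasing on `(0, ζ₀)`, `T r → −sin(πε/2) < 0` as `r → 0⁺`, `T r → ∞` as `r → ζ₀⁻`;
consequently `T` has a unique zero in `(0, ζ₀)`. -/
theorem strongly_starlike_radius_equation_unique_root
    (ζ : ℕ → ℝ) (hζpos : ∀ n, 0 < ζ n) (hζmono : StrictMono ζ)
    (hζsum : Summable fun n => 1 / (ζ n) ^ 2)
    (β ε : ℝ) (hβ : 0 < β) (hε0 : 0 < ε) (hε1 : ε ≤ 1)
    (T : ℝ → ℝ)
    (hT : ∀ r : ℝ, T r = (2 / β) * ∑' n : ℕ,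
        ((ζ n) ^ 2 * r ^ 2 / ((ζ n) ^ 4 - r ^ 4) +
          Real.sin (π * ε / 2) * r ^ 4 / ((ζ n) ^ 4 - r ^ 4)) - Real.sin (π * ε / 2)) :
    StrictMonoOn T (Set.Ioo 0 (ζ 0)) ∧
    Tendsto T (𝓝[>] 0) (𝓝 (-Real.sin (π * ε / 2))) ∧
    -Real.sin (π * ε / 2) < 0 ∧
    Tendsto T (𝓝[<] (ζ 0)) atTop ∧
    ∃! r : ℝ, r ∈ Set.Ioo 0 (ζ 0) ∧ T r = 0 := by
  set s := Real.sin (π * ε / 2)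
  have hs : 0 < s := Real.sin_pos_of_pos_of_lt_pi (by positivity) (by nlinarith [Real.pi_pos])
  have hTeq : T = fun r => (2 / β) * ∑' n, starlikeTerm s (ζ n) r - s := funext hT
  have hβ2 : 0 < 2 / β := by positivity
  have hmono : StrictMonoOn T (Set.Ico 0 (ζ 0)) := fun x hx y hy hxy => by
    have := strictMonoOn_tsum_starlikeTerm hζmono.monotone hζsum hs.le hx hy hxy
    simp only [hTeq]
    exact sub_lt_sub_right (mul_lt_mul_of_pos_left this hβ2) s
  have hcont : ContinuousOn T (Set.Ico 0 (ζ 0)) := by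
    rw [hTeq]
    exact (continuousOn_const.mul
      (continuousOn_tsum_starlikeTerm hζmono.monotone hζsum hs.le)).sub continuousOn_const
  have hzero : Tendsto T (𝓝[>] 0) (𝓝 (-s)) := by
    have hT0 : T 0 = -s := by simp [hTeq, starlikeTerm]
    have h := hcont 0 ⟨le_rfl, hζpos 0⟩
    rw [ContinuousWithinAt, hT0, nhdsWithin_Ico_eq_nhdsGE (hζpos 0)] at h
    exact h.mono_left (nhdsWithin_mono _ Set.Ioi_subset_Ici_self)
  have htop : Tendsto T (𝓝[<] (ζ 0)) atTop := by
    rw [hTeq]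
    exact tendsto_atTop_add_const_right _ _ ((tendsto_tsum_starlikeTerm_atTop
      hζmono.monotone (hζpos 0) hζsum hs.le).const_mul_atTop hβ2)
  have hmono' := hmono.mono Set.Ioo_subset_Ico_self
  refine ⟨hmono', hzero, neg_neg_of_pos hs, htop, ?_⟩
  obtain ⟨x, hx, hTx⟩ := ((eventually_mem_set.2 (Ioo_mem_nhdsGT (hζpos 0))).and
    (hzero.eventually_lt_const (neg_neg_of_pos hs))).exists
  obtain ⟨y, hy, hTy⟩ := ((eventually_mem_set.2 (Ioo_mem_nhdsLT (hζpos 0))).and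
    (htop.eventually_gt_atTop 0)).exists
  obtain ⟨r, hr, hTr⟩ := isPreconnected_Ioo.intermediate_value hx hy
    (hcont.mono Set.Ioo_subset_Ico_self) ⟨hTx.le, hTy.le⟩
  exact ⟨r, ⟨hr, hTr⟩, fun r' ⟨hr', hTr'⟩ => hmono'.injOn hr' hr (hTr'.trans hTr.symm)⟩
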